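/- arXiv:2105.11967 — 7 statements merged into one kernel-verified Lean document; each statement's English description precedes it below -/
import Mathlib

section
/- Let F be a field, V an F-vector space, v ∈ V and φ ∈ V* with φ(v) = 0, let t = t_{v,φ} ∈ End_F(V) be the infinitesimal transvection w ↦ φ(w)·v, and define g_t : End_F(V) → F by g_t(y) = −φ(y(v)). Then the Premet identities hold: for all y, z ∈ End_F(V), ⁅⁅t,y⁆,⁅t,z⁆⁆ = g_t(⁅y,z⁆)·t + g_t(z)·⁅t,y⁆ − g_t(y)·⁅t,z⁆ and ⁅t,⁅y,⁅t,z⁆⁆⁆ = g_t(⁅y,z⁆)·t − g_t(z)·⁅t,y⁆ − g_t(y)·⁅t,z⁆ (so t is an extremal element of the Lie algebra End_F(V)). -/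
/-- The infinitesimal transvection `t_{v,φ} : w ↦ φ(w) • v`. -/
def infTransvection {F : Type*} [Field F] {V : Type*} [AddCommGroup V] [Module F V]
    (v : V) (φ : Module.Dual F V) : Module.End F V :=
  φ.smulRight v

theorem infTransvection_apply {F : Type*} [Field F] {V : Type*} [AddCommGroup V] [Module F V]
    (v : V) (φ : Module.Dual F V) (w : V) : infTransvection v φ w = φ w • v :=
  rfl

/-- The Premet identities hold for an infinitesimal transvection `t = t_{v,φ}` (with
`φ(v) = 0`), with associated extremal functional `g_t(y) = −φ(y(v))`; so `t` is an
extremal element of the Lie algebra `End_F(V)`. -/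
theorem premet_identities_infTransvection (F : Type*) [Field F] (V : Type*) [AddCommGroup V]
    [Module F V] (v : V) (φ : Module.Dual F V) (hφv : φ v = 0)
    (g : Module.End F V → F) (hg : ∀ y, g y = -φ (y v)) :
    (∀ y z : Module.End F V,
      ⁅⁅infTransvection v φ, y⁆, ⁅infTransvection v φ, z⁆⁆
        = g ⁅y, z⁆ • infTransvection v φ + g z • ⁅infTransvection v φ, y⁆
          - g y • ⁅infTransvection v φ, z⁆) ∧
    (∀ y z : Module.End F V,
      ⁅infTransvection v φ, ⁅y, ⁅infTransvection v φ, z⁆⁆⁆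
        = g ⁅y, z⁆ • infTransvection v φ - g z • ⁅infTransvection v φ, y⁆
          - g y • ⁅infTransvection v φ, z⁆) := by
  refine ⟨fun y z => ?_, fun y z => ?_⟩ <;> ext w <;>
    simp only [hg, infTransvection_apply, Ring.lie_def, LinearMap.sub_apply, LinearMap.add_apply,
      LinearMap.smul_apply, Module.End.mul_apply, map_sub, map_smul, hφv] <;>
    module
end

section
/- Let 𝔤 be a Lie algebra over a field F which is generated, as a Lie algebra, by its set E of extremal elements. Then 𝔤 is linearly spanned by E, i.e., the F-linear span of the set of extremal elements of 𝔤 is all of 𝔤. -/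
/-- An element `x` of a Lie algebra `L` over `F` is *extremal* if it is nonzero and there
is a function `g_x : L → F` satisfying the extremal identity and the two Premet
identities. -/
def IsExtremal (F : Type*) [Field F] {L : Type*} [LieRing L] [LieAlgebra F L] (x : L) : Prop :=
  x ≠ 0 ∧ ∃ g : L → F,
    (∀ y, ⁅x, ⁅x, y⁆⁆ = (2 * g y) • x) ∧
    (∀ y z, ⁅⁅x, y⁆, ⁅x, z⁆⁆ = g ⁅y, z⁆ • x + g z • ⁅x, y⁆ - g y • ⁅x, z⁆) ∧
    (∀ y z, ⁅x, ⁅y, ⁅x, z⁆⁆⁆ = g ⁅y, z⁆ • x - g z • ⁅x, y⁆ - g y • ⁅x, z⁆)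

/-- `x` is a *sandwich* when `⁅x,⁅x,y⁆⁆ = 0` and `⁅x,⁅y,⁅x,z⁆⁆⁆ = 0` for all `y, z`. -/
def IsSandwich {L : Type*} [LieRing L] (x : L) : Prop :=
  (∀ y : L, ⁅x, ⁅x, y⁆⁆ = 0) ∧ ∀ y z : L, ⁅x, ⁅y, ⁅x, z⁆⁆⁆ = 0

/-- A *pure* extremal element is an extremal element that is not a sandwich. -/
def IsPureExtremal (F : Type*) [Field F] {L : Type*} [LieRing L] [LieAlgebra F L]
    (x : L) : Prop :=
  IsExtremal F x ∧ ¬ IsSandwich x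

/-- An *extremal line* of a Lie algebra `L` over `F` is a 2-dimensional subspace all of
whose nonzero elements are extremal and whose elements pairwise commute. -/
def IsExtremalLine (F : Type*) [Field F] {L : Type*} [LieRing L] [LieAlgebra F L]
    (M : Submodule F L) : Prop :=
  Module.finrank F M = 2 ∧ (∀ u ∈ M, u ≠ 0 → IsExtremal F u) ∧
    ∀ u ∈ M, ∀ w ∈ M, ⁅u, w⁆ = 0

/-- A nonzero element whose bracket with everything is a multiple of itself satisfies the
extremal identities with the zero form; in every other case the form of an extremal element is
automatically linear. Hence the form can always be chosen linear, and vanishing on `x` and on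
the image of `ad x`. -/
theorem IsExtremal.exists_linear {F : Type*} [Field F] {L : Type*} [LieRing L] [LieAlgebra F L]
    {x : L} (hx : IsExtremal F x) :
    ∃ g : L →ₗ[F] F, g x = 0 ∧ (∀ y, g ⁅x, y⁆ = 0) ∧
      (∀ y, ⁅x, ⁅x, y⁆⁆ = (2 * g y) • x) ∧
      ∀ y z, ⁅⁅x, y⁆, ⁅x, z⁆⁆ = g ⁅y, z⁆ • x + g z • ⁅x, y⁆ - g y • ⁅x, z⁆ := by
  obtain ⟨hx0, g, h1, h2, -⟩ := hx
  by_cases hdeg : ∀ z, ∃ c : F, ⁅x, z⁆ = c • x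
  · choose c hc using hdeg
    exact ⟨0, by simp, by simp, fun y ↦ by rw [hc y, lie_smul, lie_self]; simp, fun y z ↦ by simp [hc]⟩
  · push Not at hdeg
    obtain ⟨w, hw⟩ := hdeg
    have key : ∀ a b : F, a • x = b • ⁅x, w⁆ → b = 0 := by
      intro a b hab
      by_contra hb
      apply hw (b⁻¹ * a)
      rw [mul_smul, hab, inv_smul_smul₀ hb]
    have hadd : ∀ y z, g (y + z) = g y + g z := by
      intro y z
      have e : (g ⁅y + z, w⁆ - g ⁅y, w⁆ - g ⁅z, w⁆) • x
          = (g (y + z) - (g y + g z)) • ⁅x, w⁆ := by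
        have e1 := h2 (y + z) w
        rw [lie_add x, add_lie ⁅x, y⁆, h2 y w, h2 z w] at e1
        rw [eq_comm, ← sub_eq_zero] at e1
        rw [← sub_eq_zero]
        rw [← e1]
        module
      exact sub_eq_zero.mp (key _ _ e)
    have hsmul : ∀ (c : F) (y : L), g (c • y) = c * g y := by
      intro c y
      have e : (g ⁅c • y, w⁆ - c * g ⁅y, w⁆) • x = (g (c • y) - c * g y) • ⁅x, w⁆ := by
        have e1 := h2 (c • y) w
        rw [lie_smul, smul_lie c ⁅x, y⁆, h2 y w] at e1
        rw [eq_comm, ← sub_eq_zero] at e1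
        rw [← sub_eq_zero]
        rw [← e1]
        module
      exact sub_eq_zero.mp (key _ _ e)
    have hgx : g x = 0 := by
      refine key (g ⁅x, w⁆) _ ?_
      have e1 := h2 x w
      simp only [lie_self, zero_lie, smul_zero, add_zero] at e1
      exact sub_eq_zero.mp e1.symm
    refine ⟨{ toFun := g, map_add' := hadd, map_smul' := hsmul }, hgx, fun y ↦ ?_, h1, h2⟩
    have e1 := h2 x y
    rw [lie_self, zero_lie, hgx, smul_zero, zero_smul, add_zero, sub_zero] at e1
    exact (smul_eq_zero.mp e1.symm).resolve_right hx0

/-- The image of an extremal element under a Lie algebra automorphism is extremal. -/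
theorem IsExtremal.map {F : Type*} [Field F] {L : Type*} [LieRing L] [LieAlgebra F L]
    {x : L} (hx : IsExtremal F x) (φ : L ≃ₗ⁅F⁆ L) : IsExtremal F (φ x) := by
  obtain ⟨hx0, g, h1, h2, h3⟩ := hx
  refine ⟨by simpa using hx0, fun y ↦ g (φ.symm y), fun y ↦ ?_, fun y z ↦ ?_, fun y z ↦ ?_⟩
  · obtain ⟨y, rfl⟩ := φ.surjective y
    simp [← LieEquiv.map_lie, h1]
  · obtain ⟨y, rfl⟩ := φ.surjective y
    obtain ⟨z, rfl⟩ := φ.surjective z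
    simp [← LieEquiv.map_lie, h2]
  · obtain ⟨y, rfl⟩ := φ.surjective y
    obtain ⟨z, rfl⟩ := φ.surjective z
    simp [← LieEquiv.map_lie, h3]

/-- The exponential `y ↦ y + ⁅x, y⁆ + g_x(y) x` of an extremal element is an automorphism. -/
theorem IsExtremal.exists_exp {F : Type*} [Field F] {L : Type*} [LieRing L] [LieAlgebra F L]
    {x : L} (hx : IsExtremal F x) :
    ∃ (φ : L ≃ₗ⁅F⁆ L) (g : L → F), ∀ y, φ y = y + ⁅x, y⁆ + g y • x := by
  obtain ⟨g, hgx, hgl, h1, h2⟩ := hx.exists_linear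
  refine ⟨{ toFun := fun y ↦ y + ⁅x, y⁆ + g y • x
            invFun := fun y ↦ y - ⁅x, y⁆ + g y • x
            map_add' := fun y z ↦ ?_
            map_smul' := fun c y ↦ ?_
            map_lie' := fun {y z} ↦ ?_
            left_inv := fun y ↦ ?_
            right_inv := fun y ↦ ?_ }, g, fun y ↦ rfl⟩
  · simp only [lie_add, map_add]
    module
  · simp only [lie_smul, map_smul, smul_eq_mul, RingHom.id_apply]
    module
  · have hyx : ⁅y, x⁆ = -⁅x, y⁆ := (lie_skew y x).symm
    have hxyx : ⁅⁅x, y⁆, x⁆ = -⁅x, ⁅x, y⁆⁆ := (lie_skew ⁅x, y⁆ x).symm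
    simp only [add_lie, lie_add, smul_lie, lie_smul, h2, hyx, hxyx, h1, lie_self,
      leibniz_lie x y z]
    module
  · simp only [lie_add, lie_smul, lie_self, map_add, map_smul, hgx, hgl, h1]
    module
  · simp only [lie_add, lie_sub, lie_smul, lie_self, map_add, map_sub, map_smul, hgx, hgl, h1]
    module

/-- The bracket of two extremal elements is a linear combination of extremal elements. -/
theorem IsExtremal.lie_mem_span {F : Type*} [Field F] {L : Type*} [LieRing L] [LieAlgebra F L]
    {x y : L} (hx : IsExtremal F x) (hy : IsExtremal F y) :
    ⁅x, y⁆ ∈ Submodule.span F {x : L | IsExtremal F x} := by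
  obtain ⟨φ, g, hφ⟩ := hx.exists_exp
  have e : ⁅x, y⁆ = φ y - y - g y • x := by
    rw [hφ]
    abel
  rw [e]
  exact sub_mem (sub_mem (Submodule.subset_span (hy.map φ)) (Submodule.subset_span hy))
    (Submodule.smul_mem _ _ (Submodule.subset_span hx))

/-- A Lie algebra generated (as a Lie algebra) by its set of extremal elements is
linearly spanned by its extremal elements. -/
theorem span_extremal_eq_top (F : Type*) [Field F] (L : Type*) [LieRing L] [LieAlgebra F L]
    (hgen : LieSubalgebra.lieSpan F L {x | IsExtremal F x} = ⊤) :
    Submodule.span F {x : L | IsExtremal F x} = ⊤ := by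
  let S : LieSubalgebra F L :=
    { Submodule.span F {x : L | IsExtremal F x} with
      lie_mem' := fun {u v} hu hv ↦ by
        change u ∈ Submodule.span F _ at hu
        change v ∈ Submodule.span F _ at hv
        change ⁅u, v⁆ ∈ Submodule.span F _
        induction hu, hv using Submodule.span_induction₂ with
        | mem_mem u v hu hv => exact IsExtremal.lie_mem_span hu hv
        | zero_left v _ => simp
        | zero_right u _ => simp
        | add_left a b c _ _ _ h1 h2 => simpa only [add_lie] using add_mem h1 h2
        | add_right a b c _ _ _ h1 h2 => simpa only [lie_add] using add_mem h1 h2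
        | smul_left r a b _ _ h => simpa only [smul_lie] using Submodule.smul_mem _ r h
        | smul_right r a b _ _ h => simpa only [lie_smul] using Submodule.smul_mem _ r h }
  have hS : (⊤ : LieSubalgebra F L) ≤ S := by
    rw [← hgen, LieSubalgebra.lieSpan_le]
    exact Submodule.subset_span
  exact eq_top_iff.mpr fun u _ ↦ hS (LieSubalgebra.mem_top u)
end

section
/- Let 𝔤 be a simple Lie algebra over a field F which is generated, as a Lie algebra, by its set of extremal elements. If 𝔤 contains a pure extremal element, then every extremal element of 𝔤 is pure (i.e., no extremal element of 𝔤 is a sandwich). -/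
namespace LieAlgebra

variable {F : Type*} [Field F] {L : Type*} [LieRing L] [LieAlgebra F L]

/-- The linear functional `g` satisfies the extremal and Premet identities for `x`. -/
structure IsExtremalForm (x : L) (g : L →ₗ[F] F) : Prop where
  lie_lie : ∀ y, ⁅x, ⁅x, y⁆⁆ = (2 * g y) • x
  lie_lie_lie : ∀ y z, ⁅⁅x, y⁆, ⁅x, z⁆⁆ = g ⁅y, z⁆ • x + g z • ⁅x, y⁆ - g y • ⁅x, z⁆
  lie_lie_lie' : ∀ y z, ⁅x, ⁅y, ⁅x, z⁆⁆⁆ = g ⁅y, z⁆ • x - g z • ⁅x, y⁆ - g y • ⁅x, z⁆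

theorem exists_lie_notMem_span [IsSimple F L] {x : L} (hx : x ≠ 0) :
    ∃ z : L, ⁅x, z⁆ ∉ Submodule.span F {x} := by
  by_contra! h
  let I : LieIdeal F L :=
    { Submodule.span F {x} with
      lie_mem := by
        intro z m hm
        obtain ⟨c, rfl⟩ := Submodule.mem_span_singleton.1 hm
        rw [lie_smul, ← lie_skew]
        exact Submodule.smul_mem _ _ (Submodule.neg_mem _ (h z)) }
  have hxI : x ∈ I := Submodule.mem_span_singleton_self x
  rcases IsSimple.eq_bot_or_eq_top (R := F) I with hI | hI
  · rw [hI] at hxI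
    exact hx (by simpa using hxI)
  · apply IsSimple.non_abelian F (L := L)
    have key : ∀ u : L, ∃ c : F, c • x = u := fun u =>
      Submodule.mem_span_singleton.1 (show u ∈ I by rw [hI]; trivial)
    refine ⟨fun u v => ?_⟩
    obtain ⟨c, rfl⟩ := key u
    obtain ⟨d, rfl⟩ := key v
    simp

theorem exists_isExtremalForm [IsSimple F L] {x : L} (hx : IsExtremal F x) :
    ∃ g : L →ₗ[F] F, IsExtremalForm x g := by
  obtain ⟨hx0, g, h1, h2, h3⟩ := hx
  obtain ⟨z, hz⟩ := exists_lie_notMem_span (F := F) hx0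
  have key : ∀ a b : F, a • ⁅x, z⁆ = b • x → a = 0 := by
    intro a b hab
    by_contra ha
    apply hz
    refine Submodule.mem_span_singleton.2 ⟨a⁻¹ * b, ?_⟩
    rw [mul_smul, ← hab, inv_smul_smul₀ ha]
  refine ⟨{ toFun := g, map_add' := fun u v => ?_, map_smul' := fun c u => ?_ }, ⟨h1, h2, h3⟩⟩
  · have e : ⁅⁅x, u + v⁆, ⁅x, z⁆⁆ = ⁅⁅x, u⁆, ⁅x, z⁆⁆ + ⁅⁅x, v⁆, ⁅x, z⁆⁆ := by
      rw [lie_add, add_lie]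
    rw [h2, h2, h2, lie_add] at e
    refine sub_eq_zero.1 (key _ (g ⁅u + v, z⁆ - g ⁅u, z⁆ - g ⁅v, z⁆) ?_)
    linear_combination (norm := module) (-1 : F) • e
  · have e : ⁅⁅x, c • u⁆, ⁅x, z⁆⁆ = c • ⁅⁅x, u⁆, ⁅x, z⁆⁆ := by
      rw [lie_smul, smul_lie]
    rw [h2, h2, lie_smul] at e
    refine sub_eq_zero.1 (key _ (g ⁅c • u, z⁆ - c * g ⁅u, z⁆) ?_)
    simp only [RingHom.id_apply, smul_eq_mul]
    linear_combination (norm := module) (-1 : F) • e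

theorem isExtremalForm_zero_of_isSandwich {x : L} (hx : IsSandwich x) :
    IsExtremalForm x (0 : L →ₗ[F] F) where
  lie_lie y := by simp [hx.1]
  lie_lie_lie y z := by
    simp [lie_lie x y ⁅x, z⁆, hx.1, hx.2]
  lie_lie_lie' y z := by simp [hx.2]

theorem isSandwich_of_isExtremalForm_zero {x : L} (h : IsExtremalForm x (0 : L →ₗ[F] F)) :
    IsSandwich x :=
  ⟨fun y => by simpa using h.lie_lie y, fun y z => by simpa using h.lie_lie_lie' y z⟩

namespace IsExtremalForm

variable {x : L} {g : L →ₗ[F] F}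

theorem apply_self [IsSimple F L] (hx : x ≠ 0) (h : IsExtremalForm x g) : g x = 0 := by
  obtain ⟨z, hz⟩ := exists_lie_notMem_span (F := F) hx
  by_contra ha
  have e := h.lie_lie_lie x z
  rw [lie_self, zero_lie, smul_zero, add_zero] at e
  refine hz (Submodule.mem_span_singleton.2 ⟨(g x)⁻¹ * g ⁅x, z⁆, ?_⟩)
  rw [mul_smul, sub_eq_zero.1 e.symm, inv_smul_smul₀ ha]

theorem apply_lie [IsSimple F L] (hx : x ≠ 0) (h : IsExtremalForm x g) (z : L) :
    g ⁅x, z⁆ = 0 := by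
  have e := h.lie_lie_lie x z
  simpa [h.apply_self hx, hx] using e.symm

/-- The exponential of an extremal element, as an automorphism. -/
def exp [IsSimple F L] (hx : x ≠ 0) (h : IsExtremalForm x g) : L ≃ₗ⁅F⁆ L where
  toFun z := z + ⁅x, z⁆ + g z • x
  invFun z := z - ⁅x, z⁆ + g z • x
  map_add' u v := by
    simp only [lie_add, map_add]
    module
  map_smul' c u := by
    simp only [lie_smul, map_smul, smul_eq_mul, RingHom.id_apply]
    module
  map_lie' {u v} := by
    have e1 : ⁅u, ⁅x, v⁆⁆ = ⁅x, ⁅u, v⁆⁆ - ⁅⁅x, u⁆, v⁆ := by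
      rw [leibniz_lie x u v]; abel
    have e2 : ⁅⁅x, u⁆, x⁆ = -((2 * g u) • x) := by rw [← lie_skew, h.lie_lie]
    have e3 : ⁅u, x⁆ = -⁅x, u⁆ := (lie_skew u x).symm
    simp only [lie_add, add_lie, lie_smul, smul_lie, h.lie_lie_lie, h.lie_lie, lie_self,
      e1, e2, e3]
    module
  left_inv z := by
    simp only [lie_add, map_add, lie_smul, map_smul, h.lie_lie, h.apply_lie hx, h.apply_self hx,
      lie_self, smul_eq_mul]
    module
  right_inv z := by
    simp only [lie_add, lie_sub, map_add, map_sub, lie_smul, map_smul, h.lie_lie,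
      h.apply_lie hx, h.apply_self hx, lie_self, smul_eq_mul]
    module

theorem exp_apply [IsSimple F L] (hx : x ≠ 0) (h : IsExtremalForm x g) (z : L) :
    h.exp hx z = z + ⁅x, z⁆ + g z • x := rfl

theorem comp_equiv (φ : L ≃ₗ⁅F⁆ L) (h : IsExtremalForm (φ x) g) :
    IsExtremalForm x (g ∘ₗ (φ : L →ₗ[F] L)) where
  lie_lie y := by
    apply φ.toLinearEquiv.injective
    have e := h.lie_lie (φ y)
    simp only [← LieEquiv.map_lie] at e
    rw [map_smul]
    exact e
  lie_lie_lie y z := by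
    apply φ.toLinearEquiv.injective
    have e := h.lie_lie_lie (φ y) (φ z)
    simp only [← LieEquiv.map_lie] at e
    rw [map_sub, map_add, map_smul, map_smul, map_smul]
    exact e
  lie_lie_lie' y z := by
    apply φ.toLinearEquiv.injective
    have e := h.lie_lie_lie' (φ y) (φ z)
    simp only [← LieEquiv.map_lie] at e
    rw [map_sub, map_sub, map_smul, map_smul, map_smul]
    exact e

/-- The form of a nonzero non-sandwich element vanishes on all sandwiches. -/
theorem apply_eq_zero_of_isSandwich [IsSimple F L] {y : L} (hy : y ≠ 0)
    (h : IsExtremalForm y g) (hys : ¬ IsSandwich y) (hx : IsSandwich x) : g x = 0 := by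
  by_contra ha
  have skew : ⁅x, y⁆ = -⁅y, x⁆ := (lie_skew x y).symm
  have hs : ⁅x, ⁅y, x⁆⁆ = 0 := by rw [← lie_skew y x, lie_neg, hx.1, neg_zero]
  have e1 : ∀ z, g x • ⁅x, ⁅y, z⁆⁆ = g ⁅x, z⁆ • ⁅x, y⁆ := by
    intro z
    have e := hx.2 y ⁅y, z⁆
    rw [h.lie_lie_lie', lie_sub, lie_sub, lie_smul, lie_smul, lie_smul, hs, smul_zero,
      sub_zero] at e
    exact (sub_eq_zero.1 e).symm
  have e2 : ∀ z, ⁅y, ⁅x, ⁅y, z⁆⁆⁆ = (-2 * g ⁅x, z⁆) • y := by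
    intro z
    have e := congrArg (fun u => ⁅y, u⁆) (e1 z)
    simp only [lie_smul, skew, lie_neg, h.lie_lie] at e
    apply smul_right_injective L ha
    simp only [e]
    module
  have e3 : ∀ z, g x • ⁅y, z⁆ = (3 * g ⁅x, z⁆) • y - g z • ⁅y, x⁆ := by
    intro z
    have e := e2 z
    rw [h.lie_lie_lie'] at e
    linear_combination (norm := module) (-1 : F) • e
  by_cases h2 : (2 : F) = 0
  · apply hys
    have hyy : ∀ z : L, ⁅y, ⁅y, z⁆⁆ = 0 := fun z => by
      rw [h.lie_lie, h2, zero_mul, zero_smul]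
    have hyy' : ∀ z : L, ⁅⁅y, z⁆, y⁆ = 0 := fun z => by rw [← lie_skew, hyy, neg_zero]
    have comm : ∀ z w : L, ⁅⁅y, z⁆, ⁅y, w⁆⁆ = 0 := by
      intro z w
      have e : ⁅g x • ⁅y, z⁆, g x • ⁅y, w⁆⁆ = 0 := by
        rw [e3, e3]
        simp [hyy, hyy']
      simpa [ha] using e
    refine ⟨hyy, fun z w => ?_⟩
    have e := h.lie_lie_lie z w
    have e' : (2 : F) • (g w • ⁅y, z⁆) = 0 := by rw [h2, zero_smul]
    rw [comm] at e
    rw [h.lie_lie_lie']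
    linear_combination (norm := module) (-1 : F) • e - e'
  · have e := e3 ⁅y, x⁆
    rw [h.lie_lie, hs, h.apply_lie hy] at e
    simp [smul_smul, ha, h2, hy] at e

end IsExtremalForm

variable (F L) in
/-- The common kernel of the forms of all nonzero non-sandwich elements. -/
def extremalRadical : Submodule F L where
  carrier := {z | ∀ (y : L) (g : L →ₗ[F] F), y ≠ 0 → ¬ IsSandwich y → IsExtremalForm y g → g z = 0}
  add_mem' hu hv y g h0 hs h := by rw [map_add, hu y g h0 hs h, hv y g h0 hs h, add_zero]
  zero_mem' _ g _ _ _ := map_zero g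
  smul_mem' c u hu y g h0 hs h := by rw [map_smul, hu y g h0 hs h, smul_zero]

theorem _root_.IsSandwich.of_map_equiv {x : L} (φ : L ≃ₗ⁅F⁆ L) (hx : IsSandwich (φ x)) :
    IsSandwich x := by
  refine ⟨fun y => φ.injective ?_, fun y z => φ.injective ?_⟩
  · have e := hx.1 (φ y)
    simp only [← LieEquiv.map_lie] at e
    exact e.trans (map_zero φ.toLinearEquiv).symm
  · have e := hx.2 (φ y) (φ z)
    simp only [← LieEquiv.map_lie] at e
    exact e.trans (map_zero φ.toLinearEquiv).symm

theorem equiv_mem_extremalRadical (φ : L ≃ₗ⁅F⁆ L) {z : L} (hz : z ∈ extremalRadical F L) :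
    φ z ∈ extremalRadical F L := by
  intro y g hy hys h
  have hφ : φ (φ.symm y) = y := φ.apply_symm_apply y
  rw [← hφ] at h
  refine hz (φ.symm y) _ (fun h0 => hy ?_) (fun hs => hys ?_) (IsExtremalForm.comp_equiv φ h)
  · rw [← hφ, h0]
    exact map_zero φ.toLinearEquiv
  · exact IsSandwich.of_map_equiv φ.symm hs

theorem lie_mem_extremalRadical_of_isExtremal [IsSimple F L] {x : L} (hx : IsExtremal F x)
    {z : L} (hz : z ∈ extremalRadical F L) : ⁅x, z⁆ ∈ extremalRadical F L := by
  obtain ⟨g, h, hgz⟩ : ∃ g : L →ₗ[F] F, IsExtremalForm x g ∧ g z = 0 := by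
    by_cases hs : IsSandwich x
    · exact ⟨0, isExtremalForm_zero_of_isSandwich hs, rfl⟩
    · obtain ⟨g, h⟩ := exists_isExtremalForm hx
      exact ⟨g, h, hz x g hx.1 hs h⟩
  have e := equiv_mem_extremalRadical (h.exp hx.1) hz
  rw [h.exp_apply, hgz, zero_smul, add_zero] at e
  simpa using Submodule.sub_mem _ e hz

theorem lie_mem_extremalRadical [IsSimple F L]
    (hgen : LieSubalgebra.lieSpan F L {x | IsExtremal F x} = ⊤) (x : L) {z : L}
    (hz : z ∈ extremalRadical F L) : ⁅x, z⁆ ∈ extremalRadical F L := by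
  let N : LieSubalgebra F L :=
    { carrier := {x | ∀ z ∈ extremalRadical F L, ⁅x, z⁆ ∈ extremalRadical F L}
      add_mem' := fun hu hv z hz => by
        rw [add_lie]
        exact Submodule.add_mem _ (hu z hz) (hv z hz)
      zero_mem' := fun z _ => by
        rw [zero_lie]
        exact Submodule.zero_mem _
      smul_mem' := fun c u hu z hz => by
        rw [smul_lie]
        exact Submodule.smul_mem _ c (hu z hz)
      lie_mem' := fun {u v} hu hv z hz => by
        rw [lie_lie]
        exact Submodule.sub_mem _ (hu _ (hv z hz)) (hv _ (hu z hz)) }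
  have hN : LieSubalgebra.lieSpan F L {x | IsExtremal F x} ≤ N :=
    LieSubalgebra.lieSpan_le.2 fun u hu z hz => lie_mem_extremalRadical_of_isExtremal hu hz
  rw [hgen] at hN
  exact hN (show x ∈ (⊤ : LieSubalgebra F L) from trivial) z hz

theorem extremalRadical_eq_bot [IsSimple F L]
    (hgen : LieSubalgebra.lieSpan F L {x | IsExtremal F x} = ⊤)
    (hpure : ∃ x : L, IsPureExtremal F x) : extremalRadical F L = ⊥ := by
  let I : LieIdeal F L :=
    { extremalRadical F L with lie_mem := fun {x _} hz => lie_mem_extremalRadical hgen x hz }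
  rcases IsSimple.eq_bot_or_eq_top (R := F) I with hI | hI
  · exact congrArg LieSubmodule.toSubmodule hI
  · obtain ⟨y, hy, hys⟩ := hpure
    obtain ⟨g, h⟩ := exists_isExtremalForm hy
    refine absurd (isSandwich_of_isExtremalForm_zero (F := F) ?_) hys
    have hg : g = 0 := by
      ext z
      have hz : z ∈ I := by rw [hI]; trivial
      exact hz y g hy.1 hys h
    exact hg ▸ h

end LieAlgebra

/-- In a simple Lie algebra generated by its extremal elements, if there is a pure
extremal element then every extremal element is pure (no extremal element is a
sandwich). -/
theorem all_extremal_pure_of_simple (F : Type*) [Field F] (L : Type*) [LieRing L]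
    [LieAlgebra F L] (hsimple : LieAlgebra.IsSimple F L)
    (hgen : LieSubalgebra.lieSpan F L {x | IsExtremal F x} = ⊤)
    (hpure : ∃ x : L, IsPureExtremal F x) :
    ∀ x : L, IsExtremal F x → IsPureExtremal F x := by
  intro x hx
  refine ⟨hx, fun hs => hx.1 ?_⟩
  have hmem : x ∈ LieAlgebra.extremalRadical F L :=
    fun y g hy hys h => h.apply_eq_zero_of_isSandwich hy hys hs
  rw [LieAlgebra.extremalRadical_eq_bot hgen hpure] at hmem
  simpa using hmem
end

section
/- Let F be a field of characteristic different from 2 and let 𝔤 be a simple Lie algebra over F which is generated, as a Lie algebra, by its pure extremal elements. Let B be a symmetric F-bilinear form on 𝔤 which is associative (B(⁅x,y⁆,z) = B(x,⁅y,z⁆) for all x,y,z ∈ 𝔤) and satisfies ⁅x,⁅x,y⁆⁆ = 2·B(x,y)·x for every extremal element x of 𝔤 and every y ∈ 𝔤. Let K be a Galois field extension of F of degree 2. Then the K-bilinear form on K ⊗_F 𝔤 obtained from B by base change to K is non-degenerate (its radical is trivial). -/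
open scoped TensorProduct

/-- Extension of scalars along a field extension preserves triviality of the left radical of a
bilinear form, without any finiteness assumption. -/
theorem LinearMap.BilinForm.separatingLeft_baseChange {F V : Type*} [Field F] [AddCommGroup V]
    [Module F V] (K : Type*) [Field K] [Algebra F K] {B : LinearMap.BilinForm F V}
    (hB : B.SeparatingLeft) : (LinearMap.BilinForm.baseChange K B).SeparatingLeft := by
  classical
  intro v hv
  let b := Module.Basis.ofVectorSpace F K
  obtain ⟨c, rfl⟩ := (TensorProduct.equivFinsuppOfBasisLeft (N := V) b).symm.surjective v
  have hc : c = 0 := by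
    ext i
    refine hB _ fun y => ?_
    have h := hv (1 ⊗ₜ y)
    rw [TensorProduct.equivFinsuppOfBasisLeft_symm_apply] at h
    simp only [Finsupp.sum, map_sum, LinearMap.sum_apply, LinearMap.BilinForm.baseChange_tmul,
      mul_one] at h
    have hli := linearIndependent_iff'.mp b.linearIndependent c.support (fun j => B (c j) y)
      (by simpa [Algebra.smul_def, mul_comm] using h) i
    by_cases hi : i ∈ c.support
    · exact hli hi
    · simp [Finsupp.notMem_support_iff.mp hi]
  simp [hc]

/-- The left radical of an associative symmetric bilinear form on a Lie algebra, as an ideal. -/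
def LieIdeal.radicalOfAssociative {F L : Type*} [Field F] [LieRing L] [LieAlgebra F L]
    (B : LinearMap.BilinForm F L) (hsymm : ∀ x y : L, B x y = B y x)
    (hassoc : ∀ x y z : L, B ⁅x, y⁆ z = B x ⁅y, z⁆) : LieIdeal F L where
  __ := LinearMap.ker B
  lie_mem {x m} hm := by
    have hm : B m = 0 := hm
    change B ⁅x, m⁆ = 0
    ext z
    rw [hassoc, hsymm, hassoc, hm]
    simp

/-- An extremal element of square zero is a sandwich in characteristic different from 2. -/
theorem IsExtremal.isSandwich {F L : Type*} [Field F] [LieRing L] [LieAlgebra F L]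
    (h2 : (2 : F) ≠ 0) {x : L} (hx : IsExtremal F x) (hsq : ∀ y : L, ⁅x, ⁅x, y⁆⁆ = 0) :
    IsSandwich x := by
  obtain ⟨hx0, g, hg, -, hP⟩ := hx
  have hg0 : ∀ y, g y = 0 := fun y => by
    have h := hg y
    rw [hsq, eq_comm, smul_eq_zero] at h
    simpa [h2, hx0] using h
  exact ⟨hsq, fun y z => by simp [hP, hg0]⟩

/-- A simple Lie algebra generated by its pure extremal elements has a pure extremal element. -/
theorem exists_isPureExtremal (F L : Type*) [Field F] [LieRing L] [LieAlgebra F L]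
    (hsimple : LieAlgebra.IsSimple F L)
    (hgen : LieSubalgebra.lieSpan F L {x | IsPureExtremal F x} = ⊤) :
    ∃ x : L, IsPureExtremal F x := by
  by_contra! h
  rw [Set.eq_empty_of_forall_notMem (s := {x : L | IsPureExtremal F x}) h,
    LieSubalgebra.span_empty] at hgen
  refine hsimple.non_abelian ⟨fun x y => ?_⟩
  have hx : x ∈ (⊥ : LieSubalgebra F L) := hgen ▸ LieSubalgebra.mem_top x
  rw [LieSubalgebra.mem_bot] at hx
  simp [hx]

/-- If `B` is the (symmetric, associative) extremal form of a simple Lie algebra over a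
field of characteristic not 2 generated by its pure extremal elements, then after base
change along a quadratic Galois extension the resulting bilinear form is
non-degenerate. -/
theorem baseChange_extremal_form_nondegenerate (F : Type*) [Field F]
    (hchar : ringChar F ≠ 2)
    (L : Type*) [LieRing L] [LieAlgebra F L]
    (hsimple : LieAlgebra.IsSimple F L)
    (hgen : LieSubalgebra.lieSpan F L {x | IsPureExtremal F x} = ⊤)
    (B : LinearMap.BilinForm F L)
    (hsymm : ∀ x y : L, B x y = B y x)
    (hassoc : ∀ x y z : L, B ⁅x, y⁆ z = B x ⁅y, z⁆)
    (hextr : ∀ x : L, IsExtremal F x → ∀ y : L, ⁅x, ⁅x, y⁆⁆ = (2 * B x y) • x)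
    (K : Type*) [Field K] [Algebra F K] [IsGalois F K] (hdeg : Module.finrank F K = 2) :
    (LinearMap.BilinForm.baseChange K B).Nondegenerate := by
  have h2 : (2 : F) ≠ 0 := Ring.two_ne_zero hchar
  have hB : B.SeparatingLeft := by
    rw [LinearMap.separatingLeft_iff_ker_eq_bot]
    rcases hsimple.eq_bot_or_eq_top (LieIdeal.radicalOfAssociative B hsymm hassoc) with h | h
    · exact congrArg LieSubmodule.toSubmodule h
    · obtain ⟨x, hx, hns⟩ := exists_isPureExtremal F L hsimple hgen
      have hBx : B x = 0 := by
        have : x ∈ LieIdeal.radicalOfAssociative B hsymm hassoc := h ▸ LieSubmodule.mem_top x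
        exact this
      exact absurd (hx.isSandwich h2 fun y => by simp [hextr x hx, hBx]) hns
  have hK := LinearMap.BilinForm.separatingLeft_baseChange K hB
  have hKsymm := LinearMap.BilinForm.IsSymm.baseChange K ⟨hsymm⟩
  exact ⟨hK, fun y hy => hK y fun x => (hKsymm.eq x y).symm.trans (hy x)⟩
end

section
/- Let F be a field of characteristic different from 2, let 𝔤 be a simple Lie algebra over F generated, as a Lie algebra, by its pure extremal elements, and let K be a Galois field extension of F of degree 2. Then the base-changed Lie algebra K ⊗_F 𝔤 is a simple Lie algebra over K. -/
open scoped TensorProduct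

/-- Over a field of characteristic not 2, a pure extremal element `x` satisfies
`⁅x, ⁅x, L⁆⁆ = F x ≠ 0`. -/
theorem IsPureExtremal.exists_lie_lie_eq_smul {F L : Type*} [Field F] [LieRing L]
    [LieAlgebra F L] (h2 : (2 : F) ≠ 0) {x : L} (hx : IsPureExtremal F x) :
    ∃ f : L → F, (∀ y, ⁅x, ⁅x, y⁆⁆ = f y • x) ∧ ∃ y, f y ≠ 0 := by
  obtain ⟨⟨-, g, hg, -, hg'⟩, hs⟩ := hx
  refine ⟨fun y ↦ 2 * g y, hg, ?_⟩
  by_contra! h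
  have h0 (y : L) : g y = 0 := (mul_eq_zero.mp (h y)).resolve_left h2
  exact hs ⟨fun y ↦ by simp [hg, h0], fun y z ↦ by simp [hg', h0]⟩

/-- In a quadratic field extension, there is a basis of the form `1, e`. -/
theorem exists_eq_algebraMap_add_mul_of_finrank_eq_two {F K : Type*} [Field F] [Field K]
    [Algebra F K] (hdeg : Module.finrank F K = 2) :
    ∃ e : K, (∀ a b : F, b ≠ 0 → algebraMap F K a + algebraMap F K b * e ≠ 0) ∧
      ∀ k : K, ∃ a b : F, k = algebraMap F K a + algebraMap F K b * e := by
  obtain ⟨e, he⟩ : ∃ e : K, e ∉ (⊥ : Subalgebra F K) := by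
    by_contra! h
    have := (Subalgebra.bot_eq_top_iff_finrank_eq_one (F := F) (E := K)).mp
      (eq_top_iff.mpr fun k _ ↦ h k)
    omega
  have hne (a b : F) (hb : b ≠ 0) : algebraMap F K a + algebraMap F K b * e ≠ 0 := by
    intro h
    refine he (Algebra.mem_bot.mpr ⟨-a / b, ?_⟩)
    have hb' : algebraMap F K b ≠ 0 := by simpa using hb
    rw [map_div₀, map_neg, div_eq_iff hb']
    linear_combination -h
  have hli : LinearIndependent F ![1, e] := by
    rw [LinearIndependent.pair_iff]
    intro a b h
    simp only [Algebra.smul_def, mul_one] at h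
    have hb : b = 0 := by
      by_contra hb
      exact hne a b hb h
    subst hb
    simpa using h
  have : FiniteDimensional F K := Module.finite_of_finrank_pos (by omega)
  have hspan := hli.span_eq_top_of_card_eq_finrank' (by simp [hdeg])
  refine ⟨e, hne, fun k ↦ ?_⟩
  have hk : k ∈ Submodule.span F (Set.range ![1, e]) := hspan ▸ Submodule.mem_top
  rw [Matrix.range_cons_cons_empty, Submodule.mem_span_pair] at hk
  obtain ⟨a, b, rfl⟩ := hk
  exact ⟨a, b, by simp [Algebra.smul_def]⟩

namespace LieIdeal

variable {F L K : Type*} [Field F] [LieRing L] [LieAlgebra F L] [Field K] [Algebra F K]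

/-- The elements `y` such that `e ⊗ y` is congruent to an element of `1 ⊗ L` modulo `I`. -/
def coeffIdeal (I : LieIdeal K (K ⊗[F] L)) (e : K) : LieIdeal F L where
  carrier := {y | ∃ x : L, (1 : K) ⊗ₜ[F] x + e ⊗ₜ[F] y ∈ I}
  zero_mem' := ⟨0, by simp⟩
  add_mem' := by
    rintro y y' ⟨x, hx⟩ ⟨x', hx'⟩
    refine ⟨x + x', ?_⟩
    rw [TensorProduct.tmul_add, TensorProduct.tmul_add, add_add_add_comm]
    exact I.add_mem hx hx'
  smul_mem' := by
    rintro c y ⟨x, hx⟩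
    refine ⟨c • x, ?_⟩
    have := I.smul_mem (algebraMap F K c) hx
    rwa [algebraMap_smul, smul_add, ← TensorProduct.tmul_smul, ← TensorProduct.tmul_smul] at this
  lie_mem := by
    rintro z y ⟨x, hx⟩
    refine ⟨⁅z, x⁆, ?_⟩
    have := I.lie_mem (x := (1 : K) ⊗ₜ[F] z) hx
    simpa using this

theorem mem_coeffIdeal {I : LieIdeal K (K ⊗[F] L)} {e : K} {y : L} :
    y ∈ I.coeffIdeal e ↔ ∃ x : L, (1 : K) ⊗ₜ[F] x + e ⊗ₜ[F] y ∈ I :=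
  Iff.rfl

/-- If `L` is simple, an ideal of `K ⊗ L` containing a nonzero pure tensor is everything. -/
theorem eq_top_of_tmul_mem (hsimple : LieAlgebra.IsSimple F L) {I : LieIdeal K (K ⊗[F] L)}
    {k : K} (hk : k ≠ 0) {x : L} (hx : x ≠ 0) (h : k ⊗ₜ[F] x ∈ I) : I = ⊤ := by
  have hscale {k : K} (hk : k ≠ 0) {x : L} (h : k ⊗ₜ[F] x ∈ I) (k' : K) : k' ⊗ₜ[F] x ∈ I := by
    have := I.smul_mem (k' * k⁻¹) h
    rwa [TensorProduct.smul_tmul', smul_eq_mul, inv_mul_cancel_right₀ hk] at this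
  let J : LieIdeal F L :=
    { carrier := {y | (1 : K) ⊗ₜ[F] y ∈ I}
      zero_mem' := by simp
      add_mem' := fun ha hb ↦ by
        simpa [TensorProduct.tmul_add] using I.add_mem ha hb
      smul_mem' := fun c y hy ↦ by
        have := I.smul_mem (algebraMap F K c) hy
        rwa [algebraMap_smul, ← TensorProduct.tmul_smul] at this
      lie_mem := fun {z y} hy ↦ by
        simpa using I.lie_mem (x := (1 : K) ⊗ₜ[F] z) hy }
  have hJ : J = ⊤ := by
    refine (hsimple.eq_bot_or_eq_top J).resolve_left fun hbot ↦ hx ?_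
    have : x ∈ J := hscale hk h 1
    rwa [hbot, LieSubmodule.mem_bot] at this
  refine eq_top_iff.mpr fun t _ ↦ ?_
  induction t with
  | zero => exact I.zero_mem
  | tmul k y => exact hscale one_ne_zero (show y ∈ J from hJ ▸ LieSubmodule.mem_top y) k
  | add s t hs ht => exact I.add_mem (hs trivial) (ht trivial)

end LieIdeal

/-- A simple Lie algebra over a field of characteristic not 2 generated by its pure
extremal elements stays simple after base change along a quadratic Galois extension. -/
theorem baseChange_simple (F : Type*) [Field F] (hchar : ringChar F ≠ 2)
    (L : Type*) [LieRing L] [LieAlgebra F L]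
    (hsimple : LieAlgebra.IsSimple F L)
    (hgen : LieSubalgebra.lieSpan F L {x | IsPureExtremal F x} = ⊤)
    (K : Type*) [Field K] [Algebra F K] [IsGalois F K] (hdeg : Module.finrank F K = 2) :
    LieAlgebra.IsSimple K (K ⊗[F] L) := by
  have h2 : (2 : F) ≠ 0 := Ring.two_ne_zero hchar
  obtain ⟨x, hx⟩ : ∃ x : L, IsPureExtremal F x := by
    by_contra! h
    refine hsimple.non_abelian ⟨fun a b ↦ ?_⟩
    have ha : a ∈ LieSubalgebra.lieSpan F L {x | IsPureExtremal F x} := hgen ▸ trivial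
    simp only [h, Set.ofPred_false, LieSubalgebra.span_empty, LieSubalgebra.mem_bot] at ha
    simp [ha]
  obtain ⟨f, hf, y, hy⟩ := hx.exists_lie_lie_eq_smul h2
  obtain ⟨e, he, hspan⟩ := exists_eq_algebraMap_add_mul_of_finrank_eq_two hdeg
  have hdecomp (t : K ⊗[F] L) : ∃ a b : L, t = (1 : K) ⊗ₜ[F] a + e ⊗ₜ[F] b := by
    induction t with
    | zero => exact ⟨0, 0, by simp⟩
    | tmul k z =>
      obtain ⟨a, b, rfl⟩ := hspan k
      refine ⟨a • z, b • z, ?_⟩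
      rw [← TensorProduct.smul_tmul, ← TensorProduct.smul_tmul, ← TensorProduct.add_tmul,
        Algebra.smul_def, Algebra.smul_def, mul_one]
    | add s t hs ht =>
      obtain ⟨a, b, rfl⟩ := hs
      obtain ⟨c, d, rfl⟩ := ht
      exact ⟨a + c, b + d, by simp only [TensorProduct.tmul_add]; abel⟩
  refine ⟨fun I ↦ or_iff_not_imp_left.mpr fun hI ↦ ?_, fun hab ↦ ?_⟩
  · rcases hsimple.eq_bot_or_eq_top (I.coeffIdeal e) with hJ | hJ
    · obtain ⟨t, ht, ht0⟩ : ∃ t ∈ I, t ≠ 0 := by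
        by_contra! h
        exact hI ((LieSubmodule.eq_bot_iff I).mpr h)
      obtain ⟨a, b, rfl⟩ := hdecomp t
      have hb : b ∈ I.coeffIdeal e := ⟨a, ht⟩
      rw [hJ, LieSubmodule.mem_bot] at hb
      subst hb
      rw [TensorProduct.tmul_zero, add_zero] at ht ht0
      exact LieIdeal.eq_top_of_tmul_mem hsimple one_ne_zero
        (fun ha ↦ ht0 (by rw [ha, TensorProduct.tmul_zero])) ht
    · obtain ⟨b, hb⟩ := LieIdeal.mem_coeffIdeal.mp
        (show y ∈ I.coeffIdeal e from hJ ▸ LieSubmodule.mem_top y)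
      refine LieIdeal.eq_top_of_tmul_mem hsimple (he (f b) (f y) hy) hx.1.1 ?_
      have := I.lie_mem (x := (1 : K) ⊗ₜ[F] x) (I.lie_mem (x := (1 : K) ⊗ₜ[F] x) hb)
      simp only [lie_add, LieAlgebra.ExtendScalars.bracket_tmul, one_mul, hf] at this
      rwa [← TensorProduct.smul_tmul, ← TensorProduct.smul_tmul, ← TensorProduct.add_tmul,
        Algebra.smul_def, Algebra.smul_def, mul_one] at this
  · refine hsimple.non_abelian ⟨fun a b ↦ ?_⟩
    have := hab.trivial ((1 : K) ⊗ₜ[F] a) ((1 : K) ⊗ₜ[F] b)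
    rw [LieAlgebra.ExtendScalars.bracket_tmul, one_mul] at this
    exact Module.FaithfullyFlat.tensorProduct_mk_injective (A := F) (B := K) L (by simpa using this)
end

section
/- Let K be a field with a field automorphism σ of order 2, F = {λ ∈ K : σ(λ) = λ} its fixed field, V a nonzero finite-dimensional K-vector space, and h a non-degenerate skew-Hermitian form on V with respect to σ. Then the unitary Lie algebra 𝔲(V,h) = {x ∈ End_K(V) : h(x(a),b) + h(a,x(b)) = 0 for all a,b ∈ V}, regarded as an F-subspace of End_K(V), equals the F-linear span of the set {T_v : v ∈ V}, where T_v(w) = h(v,w)·v. -/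
/-- A skew-Hermitian form on a `K`-vector space `V` with respect to a field automorphism
`σ`: additive in both arguments, `K`-linear in the second argument, `σ`-semilinear in the
first argument and satisfying `h v w = -σ (h w v)`. -/
structure IsSkewHermitian {K : Type*} [Field K] (σ : K ≃+* K) {V : Type*} [AddCommGroup V]
    [Module K V] (h : V → V → K) : Prop where
  add_left : ∀ u v w : V, h (u + v) w = h u w + h v w
  add_right : ∀ u v w : V, h u (v + w) = h u v + h u w
  smul_left : ∀ (a : K) (v w : V), h (a • v) w = σ a * h v w
  smul_right : ∀ (a : K) (v w : V), h v (a • w) = a * h v w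
  skew : ∀ v w : V, h v w = -σ (h w v)

/-- The subfield of `K` of elements fixed by the field automorphism `σ`. -/
def fixedSubfield (K : Type*) [Field K] (σ : K ≃+* K) : Subfield K where
  carrier := {x | σ x = x}
  mul_mem' := by
    intro a b ha hb
    simp only [Set.mem_setOf_eq] at *
    rw [map_mul, ha, hb]
  one_mem' := map_one σ
  add_mem' := by
    intro a b ha hb
    simp only [Set.mem_setOf_eq] at *
    rw [map_add, ha, hb]
  zero_mem' := map_zero σ
  neg_mem' := by
    intro a ha
    simp only [Set.mem_setOf_eq] at *
    rw [map_neg, ha]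
  inv_mem' := by
    intro a ha
    simp only [Set.mem_setOf_eq] at *
    rw [map_inv₀, ha]

/-- For a skew-Hermitian form `h` and `v ∈ V`, the endomorphism `T_v : w ↦ h(v,w) • v`. -/
def hermT {K : Type*} [Field K] {σ : K ≃+* K} {V : Type*} [AddCommGroup V] [Module K V]
    {h : V → V → K} (hh : IsSkewHermitian σ h) (v : V) : Module.End K V where
  toFun w := h v w • v
  map_add' a b := by
    show h v (a + b) • v = h v a • v + h v b • v
    rw [hh.add_right, add_smul]
  map_smul' c w := by
    show h v (c • w) • v = (RingHom.id K) c • (h v w • v)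
    rw [hh.smul_right, RingHom.id_apply, mul_smul]

/-- An involution `σ ≠ 1` of a field admits an element of trace one. -/
theorem exists_add_apply_eq_one {K : Type*} [Field K] {σ : K ≃+* K}
    (hσ2 : ∀ x, σ (σ x) = x) (hσne : σ ≠ RingEquiv.refl K) : ∃ c : K, c + σ c = 1 := by
  obtain ⟨t, ht⟩ : ∃ t : K, t + σ t ≠ 0 := by
    by_contra! H
    refine hσne (RingEquiv.ext fun a => ?_)
    have h1 : (1 : K) + 1 = 0 := by simpa using H 1
    rw [RingEquiv.refl_apply]
    linear_combination H a - a * h1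
  refine ⟨t / (t + σ t), ?_⟩
  rw [map_div₀, map_add, hσ2, add_comm (σ t) t, ← add_div, div_self ht]

namespace IsSkewHermitian

variable {K : Type*} [Field K] {σ : K ≃+* K} {V : Type*} [AddCommGroup V] [Module K V]
  {h : V → V → K}

/-- The linear map `w ↦ h v w`. -/
def toLin (hh : IsSkewHermitian σ h) (v : V) : V →ₗ[K] K where
  toFun := h v
  map_add' := hh.add_right v
  map_smul' a w := hh.smul_right a v w

/-- The additive map `v ↦ h v w`. -/
def toAddHom (hh : IsSkewHermitian σ h) (w : V) : V →+ K :=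
  AddMonoidHom.mk' (h · w) fun u v => hh.add_left u v w

theorem sum_right (hh : IsSkewHermitian σ h) {ι : Type*} (s : Finset ι) (v : V) (f : ι → V) :
    h v (∑ i ∈ s, f i) = ∑ i ∈ s, h v (f i) :=
  map_sum (hh.toLin v) f s

theorem sum_left (hh : IsSkewHermitian σ h) {ι : Type*} (s : Finset ι) (f : ι → V) (w : V) :
    h (∑ i ∈ s, f i) w = ∑ i ∈ s, h (f i) w :=
  map_sum (hh.toAddHom w) f s

theorem eq_of_forall_basis (hh : IsSkewHermitian σ h)
    (hnd : ∀ v : V, (∀ w : V, h v w = 0) → v = 0) {ι : Type*} (b : Module.Basis ι K V) {u v : V}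
    (huv : ∀ i, h u (b i) = h v (b i)) : u = v := by
  have key : hh.toLin u = hh.toLin v := b.ext huv
  refine sub_eq_zero.1 (hnd _ fun w => ?_)
  have hsub : h (u - v) w = h u w - h v w := map_sub (hh.toAddHom w) u v
  rw [hsub, sub_eq_zero]
  exact LinearMap.congr_fun key w

theorem exists_dual_basis (hh : IsSkewHermitian σ h)
    (hnd : ∀ v : V, (∀ w : V, h v w = 0) → v = 0) {ι : Type*} [Fintype ι] [DecidableEq ι]
    (b : Module.Basis ι K V) :
    ∃ f : ι → V, ∀ i j, h (f i) (b j) = if i = j then 1 else 0 := by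
  have : FiniteDimensional K V := b.finiteDimensional_of_finite
  let g : V →ₗ[K] (ι → K) := LinearMap.pi fun j => hh.toLin (b j)
  have hg : Function.Injective g := by
    intro u v huv
    refine hh.eq_of_forall_basis hnd b fun i => ?_
    rw [hh.skew u, hh.skew v]
    exact congrArg (fun x => -σ x) (congrFun huv i)
  have hs : Function.Surjective g :=
    (LinearMap.injective_iff_surjective_of_finrank_eq_finrank
      (by rw [Module.finrank_eq_card_basis b, Module.finrank_fintype_fun_eq_card])).1 hg
  choose f hf using fun i : ι => hs fun j => if i = j then -1 else 0
  refine ⟨f, fun i j => ?_⟩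
  have hij : h (b j) (f i) = if i = j then -1 else 0 := congrFun (hf i) j
  rw [hh.skew, hij]
  split_ifs <;> simp

theorem sum_smul_basis (hh : IsSkewHermitian σ h) {ι : Type*} [Fintype ι] [DecidableEq ι]
    {b : Module.Basis ι K V} {f : ι → V}
    (hf : ∀ i j, h (f i) (b j) = if i = j then 1 else 0) (w : V) :
    ∑ i, h (f i) w • b i = w := by
  have hc : ∀ i, hh.toLin (f i) = b.coord i := fun i =>
    b.ext fun j => by
      rw [b.coord_apply, b.repr_self, Finsupp.single_apply]
      exact (hf i j).trans (by simp only [eq_comm])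
  calc ∑ i, h (f i) w • b i = ∑ i, b.repr w i • b i :=
        Finset.sum_congr rfl fun i _ => congrArg (· • b i) (LinearMap.congr_fun (hc i) w)
    _ = w := b.sum_repr w

theorem sum_smul_dual_basis (hh : IsSkewHermitian σ h)
    (hnd : ∀ v : V, (∀ w : V, h v w = 0) → v = 0) {ι : Type*} [Fintype ι] [DecidableEq ι]
    {b : Module.Basis ι K V} {f : ι → V}
    (hf : ∀ i j, h (f i) (b j) = if i = j then 1 else 0) (w : V) :
    ∑ i, h (b i) w • f i = -w := by
  refine hh.eq_of_forall_basis hnd b fun j => ?_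
  have hneg : h (-w) (b j) = -h w (b j) := map_neg (hh.toAddHom (b j)) w
  rw [hh.sum_left, hneg, hh.skew w, neg_neg]
  simp [hh.smul_left, hf]

theorem hermT_polarization (hh : IsSkewHermitian σ h) (v w x : V) :
    (hermT hh (v + w) - hermT hh v - hermT hh w) x = h v x • w + h w x • v := by
  change h (v + w) x • (v + w) - h v x • v - h w x • w = _
  rw [hh.add_left]
  module

theorem hermT_mem_unitary (hh : IsSkewHermitian σ h) (v a b : V) :
    h (hermT hh v a) b + h a (hermT hh v b) = 0 := by
  change h (h v a • v) b + h a (h v b • v) = 0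
  rw [hh.smul_left, hh.smul_right, hh.skew a v]
  ring

theorem mem_span_hermT (hh : IsSkewHermitian σ h) [FiniteDimensional K V]
    (hσ2 : ∀ x, σ (σ x) = x) (hσne : σ ≠ RingEquiv.refl K)
    (hnd : ∀ v : V, (∀ w : V, h v w = 0) → v = 0) {x : Module.End K V}
    (hx : ∀ a b : V, h (x a) b + h a (x b) = 0) :
    x ∈ Submodule.span (fixedSubfield K σ) (Set.range (hermT hh)) := by
  classical
  obtain ⟨c, hc⟩ := exists_add_apply_eq_one hσ2 hσne
  let b := Module.finBasis K V
  obtain ⟨f, hf⟩ := hh.exists_dual_basis hnd b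
  have key : x = ∑ i, (hermT hh (f i + c • x (b i)) - hermT hh (f i)
      - hermT hh (c • x (b i))) := by
    ext w
    have h₁ : ∑ i, h (f i) w • x (b i) = x w := by
      simpa only [map_sum, map_smul] using congrArg x (hh.sum_smul_basis hf w)
    have h₂ : ∑ i, h (x (b i)) w • f i = x w := by
      rw [← neg_neg (x w), ← hh.sum_smul_dual_basis hnd hf (x w), ← Finset.sum_neg_distrib]
      refine Finset.sum_congr rfl fun i _ => ?_
      rw [eq_neg_of_add_eq_zero_left (hx (b i) w), neg_smul]
    simp only [LinearMap.sum_apply, hermT_polarization, hh.smul_left, Finset.sum_add_distrib,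
      smul_comm _ c, mul_smul, ← Finset.smul_sum, h₁, h₂]
    rw [← add_smul, hc, one_smul]
  rw [key]
  have hT (v : V) : hermT hh v ∈ Submodule.span (fixedSubfield K σ) (Set.range (hermT hh)) :=
    Submodule.subset_span ⟨v, rfl⟩
  exact Submodule.sum_mem _ fun i _ => sub_mem (sub_mem (hT _) (hT _)) (hT _)

end IsSkewHermitian

/-- For a non-degenerate skew-Hermitian form `h` on a nonzero finite-dimensional vector
space, the unitary Lie algebra `u(V,h)`, as an `F`-subspace of `End_K(V)` for the fixed
field `F` of `σ`, is the `F`-linear span of the endomorphisms `T_v : w ↦ h(v,w)•v`. -/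
theorem unitary_eq_span_of_reflections_and_transvections (K : Type*) [Field K]
    (σ : K ≃+* K) (hσ2 : ∀ x, σ (σ x) = x) (hσne : σ ≠ RingEquiv.refl K)
    (V : Type*) [AddCommGroup V] [Module K V] [FiniteDimensional K V] [Nontrivial V]
    (h : V → V → K) (hherm : IsSkewHermitian σ h)
    (hnd : ∀ v : V, (∀ w : V, h v w = 0) → v = 0) :
    (Submodule.span (fixedSubfield K σ) (Set.range (hermT hherm)) :
        Set (Module.End K V)) =
      {x : Module.End K V | ∀ a b : V, h (x a) b + h a (x b) = 0} := by
  refine Set.Subset.antisymm (fun x hx => ?_) fun x hx =>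
    hherm.mem_span_hermT hσ2 hσne hnd hx
  refine Submodule.span_induction (p := fun x _ => ∀ a b : V, h (x a) b + h a (x b) = 0)
    ?_ ?_ ?_ ?_ hx
  · rintro _ ⟨v, rfl⟩
    exact hherm.hermT_mem_unitary v
  · intro a b
    have h₁ : h 0 b = 0 := map_zero (hherm.toAddHom b)
    have h₂ : h a 0 = 0 := map_zero (hherm.toLin a)
    simp [h₁, h₂]
  · intro x y _ _ hx hy a b
    rw [LinearMap.add_apply, LinearMap.add_apply, hherm.add_left, hherm.add_right]
    linear_combination hx a b + hy a b
  · rintro ⟨c, hc : σ c = c⟩ x _ hx a b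
    change h (c • x a) b + h a (c • x b) = 0
    rw [hherm.smul_left, hherm.smul_right, hc]
    linear_combination c * hx a b
end

section
/- Let F be a field, V an infinite-dimensional F-vector space, and Π a subspace of V* with ann_V(Π) = {0}. Call a pair (U,Φ) admissible if U is a finite-dimensional subspace of V, Φ is a finite-dimensional subspace of Π, dim U = dim Φ ≥ 3, the characteristic of F does not divide dim U, and ann_U(Φ) = {0} (i.e., no nonzero u ∈ U satisfies φ(u) = 0 for all φ ∈ Φ). Then for any two admissible pairs (U₁,Φ₁) and (U₂,Φ₂) there exists an admissible pair (U,Φ) with U₁ + U₂ ⊆ U and Φ₁ + Φ₂ ⊆ Φ. -/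
open Module

/-- A pair `(U, Φ)` with `U ⊆ V` and `Φ ⊆ Π` finite-dimensional subspaces is *admissible*
if `dim U = dim Φ ≥ 3`, the characteristic of `F` does not divide `dim U`, and no nonzero
`u ∈ U` is annihilated by all of `Φ`. -/
def IsAdmissiblePair {F : Type*} [Field F] {V : Type*} [AddCommGroup V] [Module F V]
    (Pi : Submodule F (Module.Dual F V)) (U : Submodule F V)
    (Phi : Submodule F (Module.Dual F V)) : Prop :=
  FiniteDimensional F U ∧ FiniteDimensional F Phi ∧ Phi ≤ Pi ∧
    finrank F U = finrank F Phi ∧ 3 ≤ finrank F U ∧ ¬ (ringChar F ∣ finrank F U) ∧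
    ∀ u ∈ U, (∀ φ ∈ Phi, φ u = 0) → u = 0

/-- A subspace of the dual of a finite-dimensional space that separates points is everything. -/
lemma eq_top_of_separating {F W : Type*} [Field F] [AddCommGroup W] [Module F W]
    [FiniteDimensional F W] (S : Submodule F (Dual F W))
    (hS : ∀ w : W, (∀ φ ∈ S, φ w = 0) → w = 0) : S = ⊤ := by
  have hbot : S.dualCoannihilator = ⊥ := by
    rw [eq_bot_iff]
    intro w hw
    exact hS w ((Submodule.mem_dualCoannihilator w).1 hw)
  rw [← Subspace.dualCoannihilator_dualAnnihilator_eq (W := S), hbot,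
    Submodule.dualAnnihilator_bot]

/-- A point-separating space of functionals contains a finite-dimensional subspace which
separates the points of a given finite-dimensional subspace. -/
lemma exists_finiteDimensional_le_separating {F V : Type*} [Field F] [AddCommGroup V]
    [Module F V] (P : Submodule F (Dual F V)) (hP : ∀ v : V, (∀ φ ∈ P, φ v = 0) → v = 0)
    (W : Submodule F V) [FiniteDimensional F W] :
    ∃ Q ≤ P, FiniteDimensional F Q ∧ ∀ w ∈ W, (∀ φ ∈ Q, φ w = 0) → w = 0 := by
  let r : P →ₗ[F] Dual F W := W.subtype.dualMap ∘ₗ P.subtype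
  have hr : LinearMap.range r = ⊤ := by
    refine eq_top_of_separating _ fun w hw => Subtype.ext (hP w fun φ hφ => ?_)
    exact hw (r ⟨φ, hφ⟩) (LinearMap.mem_range_self r _)
  obtain ⟨s, hs⟩ := r.exists_rightInverse_of_surjective hr
  refine ⟨LinearMap.range (P.subtype ∘ₗ s), ?_, inferInstance, fun w hw h => ?_⟩
  · rintro _ ⟨x, rfl⟩
    exact (s x).2
  · have hw0 : ∀ ψ : Dual F W, ψ ⟨w, hw⟩ = 0 := fun ψ => by
      have hψ : r (s ψ) = ψ := LinearMap.congr_fun hs ψ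
      rw [← hψ]
      exact h _ (LinearMap.mem_range_self (P.subtype ∘ₗ s) ψ)
    exact congrArg Subtype.val ((forall_dual_apply_eq_zero_iff F _).1 hw0)

/-- Given a pairing of `V` with a finite-dimensional space `M` which is nondegenerate on the side
of `M`, a subspace of `V` disjoint from the left kernel can be enlarged to one of dimension
`dim M`. -/
lemma exists_le_finrank_eq_disjoint_ker {F V M : Type*} [Field F] [AddCommGroup V] [Module F V]
    [AddCommGroup M] [Module F M] [FiniteDimensional F M] (e : V →ₗ[F] Dual F M)
    (he : ∀ m : M, (∀ v, e v m = 0) → m = 0) (W : Submodule F V)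
    (hW : Disjoint W (LinearMap.ker e)) :
    ∃ U, W ≤ U ∧ FiniteDimensional F U ∧ finrank F U = finrank F M ∧
      Disjoint U (LinearMap.ker e) := by
  have hrange : LinearMap.range e = ⊤ :=
    eq_top_of_separating _ fun m hm => he m fun v => hm (e v) (LinearMap.mem_range_self e v)
  obtain ⟨U, hWU, hU⟩ := hW.exists_isCompl
  let E : U ≃ₗ[F] Dual F M :=
    (Submodule.quotientEquivOfIsCompl _ U hU.symm).symm ≪≫ₗ
      e.quotKerEquivOfSurjective (LinearMap.range_eq_top.1 hrange)
  exact ⟨U, hWU, E.symm.finiteDimensional, E.finrank_eq.trans Subspace.dual_finrank_eq,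
    hU.disjoint⟩

/-- If a finite-dimensional space `Q` of functionals separates the points of `W`, then `W` can be
enlarged to a subspace of dimension `dim Q` whose points `Q` still separates. -/
lemma exists_le_finrank_eq_separating {F V : Type*} [Field F] [AddCommGroup V] [Module F V]
    (Q : Submodule F (Dual F V)) [FiniteDimensional F Q] (W : Submodule F V)
    (hW : ∀ w ∈ W, (∀ φ ∈ Q, φ w = 0) → w = 0) :
    ∃ U, W ≤ U ∧ FiniteDimensional F U ∧ finrank F U = finrank F Q ∧
      ∀ u ∈ U, (∀ φ ∈ Q, φ u = 0) → u = 0 := by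
  obtain ⟨U, hWU, hfin, hrank, hU⟩ :=
    exists_le_finrank_eq_disjoint_ker (F := F) (V := V) (M := Q) Q.subtype.flip
      (fun φ hφ => Subtype.ext (LinearMap.ext hφ)) W
      (Submodule.disjoint_def.2 fun w hw h => hW w hw fun φ hφ =>
        LinearMap.congr_fun (LinearMap.mem_ker.1 h) (⟨φ, hφ⟩ : Q))
  exact ⟨U, hWU, hfin, hrank, fun u hu h => Submodule.disjoint_def.1 hU u hu
    (LinearMap.mem_ker.2 (LinearMap.ext fun φ => h φ.1 φ.2))⟩

/-- A point-separating space of functionals on an infinite-dimensional space is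
infinite-dimensional. -/
lemma not_finiteDimensional_of_separating {F V : Type*} [Field F] [AddCommGroup V]
    [Module F V] (hV : ¬ FiniteDimensional F V) (P : Submodule F (Dual F V))
    (hP : ∀ v : V, (∀ φ ∈ P, φ v = 0) → v = 0) : ¬ FiniteDimensional F P := by
  intro _
  obtain ⟨U, hU, hfin, -⟩ := exists_le_finrank_eq_separating P ⊤ fun v _ => hP v
  rw [top_le_iff.1 hU] at hfin
  exact hV (Submodule.topEquiv.finiteDimensional (K := F))

/-- In an infinite-dimensional `P`, every finite-dimensional subspace can be enlarged so that
the characteristic does not divide its dimension. -/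
lemma exists_le_not_ringChar_dvd_finrank {F M : Type*} [Field F] [AddCommGroup M] [Module F M]
    (P Q : Submodule F M) (hP : ¬ FiniteDimensional F P) [FiniteDimensional F Q] (hQ : Q ≤ P) :
    ∃ R, Q ≤ R ∧ R ≤ P ∧ FiniteDimensional F R ∧ ¬ ringChar F ∣ finrank F R := by
  by_cases hdvd : ringChar F ∣ finrank F Q
  · obtain ⟨x, hx, hxQ⟩ : ∃ x ∈ P, x ∉ Q := by
      by_contra! h
      exact hP (Submodule.finiteDimensional_of_le (show P ≤ Q from h))
    refine ⟨Q ⊔ Submodule.span F {x}, le_sup_left, sup_le hQ ?_, inferInstance, fun h => ?_⟩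
    · rwa [Submodule.span_singleton_le_iff_mem]
    · have hrank : finrank F ↥(Q ⊔ Submodule.span F {x}) = finrank F Q + 1 := by
        have hx0 : x ≠ 0 := fun h0 => hxQ (h0 ▸ Q.zero_mem)
        have hd : Q ⊓ Submodule.span F {x} = ⊥ :=
          disjoint_iff.1 ((Submodule.disjoint_span_singleton' hx0).2 hxQ)
        have := Submodule.finrank_sup_add_finrank_inf_eq Q (Submodule.span F {x})
        rwa [hd, finrank_bot, add_zero, finrank_span_singleton hx0] at this
      rw [hrank, Nat.dvd_add_right hdvd, Nat.dvd_one] at h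
      exact CharP.ringChar_ne_one h
  · exact ⟨Q, le_rfl, hQ, inferInstance, hdvd⟩

/-- The admissible pairs form a directed set: any two admissible pairs are dominated by a
third one. -/
theorem admissible_pairs_directed (F : Type*) [Field F] (V : Type*) [AddCommGroup V]
    [Module F V] (hV : ¬ FiniteDimensional F V)
    (Pi : Submodule F (Module.Dual F V))
    (hann : ∀ v : V, (∀ φ ∈ Pi, φ v = 0) → v = 0)
    (U₁ U₂ : Submodule F V) (Phi₁ Phi₂ : Submodule F (Module.Dual F V))
    (h1 : IsAdmissiblePair Pi U₁ Phi₁) (h2 : IsAdmissiblePair Pi U₂ Phi₂) :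
    ∃ (U : Submodule F V) (Phi : Submodule F (Module.Dual F V)),
      IsAdmissiblePair Pi U Phi ∧ U₁ ⊔ U₂ ≤ U ∧ Phi₁ ⊔ Phi₂ ≤ Phi := by
  obtain ⟨_, _, hle₁, hrank, hthree, -, -⟩ := h1
  obtain ⟨_, _, hle₂, -⟩ := h2
  obtain ⟨Q, hQPi, _, hQ⟩ := exists_finiteDimensional_le_separating Pi hann (U₁ ⊔ U₂)
  obtain ⟨R, hQR, hRPi, _, hdvd⟩ := exists_le_not_ringChar_dvd_finrank Pi (Phi₁ ⊔ Phi₂ ⊔ Q)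
    (not_finiteDimensional_of_separating hV Pi hann) (sup_le (sup_le hle₁ hle₂) hQPi)
  obtain ⟨U, hU, hfin, hUR, hsep⟩ := exists_le_finrank_eq_separating R (U₁ ⊔ U₂)
    fun w hw h => hQ w hw fun φ hφ => h φ (hQR (le_sup_right (a := Phi₁ ⊔ Phi₂) hφ))
  have hPhi : Phi₁ ⊔ Phi₂ ≤ R := le_sup_left.trans hQR
  have hge : 3 ≤ finrank F U := by
    rw [hUR]
    exact (hrank ▸ hthree).trans (Submodule.finrank_mono (le_sup_left.trans hPhi))
  exact ⟨U, R, ⟨hfin, inferInstance, hRPi, hUR, hge, hUR ▸ hdvd, hsep⟩, hU, hPhi⟩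
end
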